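/- Let p be an odd prime, q = p^m a power of p, and suppose q = 2^a·b − 1 with b odd and a ≥ 2. Let r ≥ 3 and n = 2^r. Then the set T_n = {0, 2^{r−1}, 2^{r−2}} ∪ ⋃_{i=3}^r { 2^{r−i}·s : s ∈ O_i } is a complete set of representatives of the q-cyclotomic cosets modulo 2^r: the cosets C_(t,2^r) for t ∈ T_n are pairwise disjoint and their union is all of Z/2^rZ. -/

import Mathlib

/-- The `q`-cyclotomic coset of the integer `t` modulo `n`, viewed inside `ZMod n`:
`C_(t,n) = { t·q^k mod n : k ≥ 0 }`. -/
def cycCoset (q n : ℕ) (t : ℤ) : Set (ZMod n) :=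
  {z | ∃ k : ℕ, z = (t : ZMod n) * (q : ZMod n) ^ k}

/-- Representatives of the odd residues modulo `2 ^ i` up to powers of `q = 2 ^ a * b - 1`. -/
def oddReps (a i : ℕ) : Set ℤ :=
  {x | (i ≤ a ∧ ∃ v : ℕ, v ≤ 2 ^ (i - 2) - 1 ∧ x = 3 ^ v) ∨
    (a < i ∧ ∃ v : ℕ, v ≤ 2 ^ (a - 2) - 1 ∧ (x = 3 ^ v ∨ x = -(3 ^ v)))}

lemma dvd_of_dvd_of_eq {d x y : ℤ} (h : d ∣ x) (hxy : x = y) : d ∣ y := hxy ▸ h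

lemma odd_of_mem_oddReps {a i : ℕ} {x : ℤ} (hx : x ∈ oddReps a i) : Odd x := by
  have h3 : ∀ v : ℕ, Odd ((3 : ℤ) ^ v) := fun v => Odd.pow (by decide)
  rcases hx with ⟨-, v, -, rfl⟩ | ⟨-, v, -, rfl | rfl⟩
  exacts [h3 v, h3 v, (h3 v).neg]

/-- Repeated squaring of `1 + 2 ^ i * c` with `c` odd raises the exponent by one at each step. -/
lemma exists_odd_pow_two_pow {u : ℤ} {i : ℕ} (hi : 2 ≤ i)
    (hu : ∃ c : ℤ, Odd c ∧ u = 1 + 2 ^ i * c) (j : ℕ) :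
    ∃ c : ℤ, Odd c ∧ u ^ 2 ^ j = 1 + 2 ^ (i + j) * c := by
  induction j with
  | zero => simpa using hu
  | succ j ih =>
    obtain ⟨c, hc, h⟩ := ih
    obtain ⟨k, hk⟩ : ∃ k, i + j = k + 2 := ⟨i + j - 2, by omega⟩
    refine ⟨c + 2 * (2 ^ k * c ^ 2), hc.add_even (even_two_mul _), ?_⟩
    rw [pow_succ 2 j, pow_mul, h, ← add_assoc, hk]
    ring

lemma dvd_sub_or_dvd_sub_mul {x y u c : ℤ} {i : ℕ} (hy : Odd y) (hc : Odd c)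
    (hu : u = 1 + 2 ^ i * c) (h : (2 : ℤ) ^ i ∣ x - y) :
    (2 : ℤ) ^ (i + 1) ∣ x - y ∨ (2 : ℤ) ^ (i + 1) ∣ x - y * u := by
  obtain ⟨d, hd⟩ := h
  rcases Int.even_or_odd d with he | ho
  · left
    rw [hd, pow_succ]
    exact mul_dvd_mul_left _ he.two_dvd
  · right
    have : x - y * u = 2 ^ i * (d - y * c) := by rw [hu]; linear_combination hd
    rw [this, pow_succ]
    exact mul_dvd_mul_left _ (ho.sub_odd (hy.mul hc)).two_dvd

lemma exists_three_pow_two_pow (j : ℕ) :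
    ∃ c : ℤ, Odd c ∧ (3 : ℤ) ^ 2 ^ (j + 1) = 1 + 2 ^ (j + 3) * c := by
  have h := exists_odd_pow_two_pow (u := 3 ^ 2) (i := 3) (by norm_num)
    ⟨1, odd_one, by norm_num⟩ j
  rw [← pow_mul, ← pow_succ', add_comm 3 j] at h
  exact h

lemma three_pow_emod_eight (v : ℕ) :
    (Even v ∧ (3 : ℤ) ^ v % 8 = 1) ∨ (Odd v ∧ (3 : ℤ) ^ v % 8 = 3) := by
  induction v with
  | zero => simp
  | succ v ih =>
    rcases ih with ⟨hv, h⟩ | ⟨hv, h⟩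
    · exact Or.inr ⟨hv.add_one, by omega⟩
    · exact Or.inl ⟨hv.add_one, by omega⟩

/-- Every odd integer is `± 3 ^ v` modulo `2 ^ (j + 3)`. -/
lemma exists_three_pow_sign (j : ℕ) {x : ℤ} (hx : Odd x) :
    ∃ v : ℕ, v < 2 ^ (j + 1) ∧ ∃ e : ℤ, (e = 1 ∨ e = -1) ∧ (2 : ℤ) ^ (j + 3) ∣ x - e * 3 ^ v := by
  induction j with
  | zero =>
    have : x % 8 = 1 ∨ x % 8 = 3 ∨ x % 8 = 5 ∨ x % 8 = 7 := by
      rcases hx with ⟨k, hk⟩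
      omega
    rcases this with h | h | h | h
    · exact ⟨0, by norm_num, 1, by norm_num, by norm_num; omega⟩
    · exact ⟨1, by norm_num, 1, by norm_num, by norm_num; omega⟩
    · exact ⟨1, by norm_num, -1, by norm_num, by norm_num; omega⟩
    · exact ⟨0, by norm_num, -1, by norm_num, by norm_num; omega⟩
  | succ j ih =>
    obtain ⟨v, hv, e, he, h⟩ := ih
    obtain ⟨c, hc, hu⟩ := exists_three_pow_two_pow j
    have hodd : Odd (e * 3 ^ v) :=
      (by rcases he with rfl | rfl <;> decide : Odd e).mul (Odd.pow (by decide))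
    have hp : 2 ^ (j + 1 + 1) = 2 ^ (j + 1) + 2 ^ (j + 1) := by ring
    rcases dvd_sub_or_dvd_sub_mul hodd hc hu h with h' | h'
    · exact ⟨v, by omega, e, he, h'⟩
    · exact ⟨v + 2 ^ (j + 1), by omega, e, he, by rwa [pow_add 3, ← mul_assoc]⟩

lemma two_pow_dvd_of_dvd_three_pow_sub_one (j : ℕ) {v : ℕ}
    (h : (2 : ℤ) ^ (j + 3) ∣ 3 ^ v - 1) : 2 ^ (j + 1) ∣ v := by
  induction j generalizing v with
  | zero =>
    norm_num at h ⊢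
    rcases three_pow_emod_eight v with ⟨hv, -⟩ | ⟨-, h'⟩
    · exact hv.two_dvd
    · omega
  | succ j ih =>
    obtain ⟨w, rfl⟩ := ih ((pow_dvd_pow 2 (by omega)).trans h)
    obtain ⟨c, hc, hu⟩ := exists_three_pow_two_pow j
    obtain ⟨d, hd, hu'⟩ := exists_three_pow_two_pow (j + 1)
    rcases Nat.even_or_odd' w with ⟨t, rfl | rfl⟩
    · exact ⟨t, by ring⟩
    exfalso
    have h1 : (2 : ℤ) ^ (j + 1 + 3) ∣ 3 ^ (2 ^ (j + 1 + 1) * t) - 1 := by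
      rw [pow_mul, hu']
      exact (Dvd.intro d (by ring)).trans (sub_one_dvd_pow_sub_one _ t)
    have h2 : (3 : ℤ) ^ (2 ^ (j + 1) * (2 * t + 1)) - 1 =
        (3 ^ (2 ^ (j + 1 + 1) * t) - 1) * 3 ^ 2 ^ (j + 1) + 2 ^ (j + 3) * c := by
      rw [show 2 ^ (j + 1) * (2 * t + 1) = 2 ^ (j + 1 + 1) * t + 2 ^ (j + 1) by ring, pow_add]
      linear_combination hu
    rw [h2] at h
    have h3 := (dvd_add_right (h1.mul_right _)).1 h
    rw [show j + 1 + 3 = (j + 3) + 1 by ring, pow_succ] at h3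
    have h4 := Int.dvd_of_mul_dvd_mul_left (by positivity) h3
    rcases hc with ⟨k, hk⟩
    omega

lemma isCoprime_two_pow {x : ℤ} (hx : Odd x) (i : ℕ) : IsCoprime ((2 : ℤ) ^ i) x :=
  (Int.isCoprime_two_left.2 hx).pow_left

/-- `3 ^ v` modulo `2 ^ (j + 3)` determines `v < 2 ^ (j + 1)`, even up to sign. -/
lemma three_pow_inj_sign (j : ℕ) {v w : ℕ} (hv : v < 2 ^ (j + 1)) (hw : w < 2 ^ (j + 1)) {e : ℤ}
    (he : e = 1 ∨ e = -1) (h : (2 : ℤ) ^ (j + 3) ∣ 3 ^ v - e * 3 ^ w) : v = w := by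
  have key : ∀ {v w : ℕ}, w < 2 ^ (j + 1) → v ≤ w → (2 : ℤ) ^ (j + 3) ∣ 3 ^ v - 3 ^ w → v = w := by
    intro v w hw hvw h
    obtain ⟨k, rfl⟩ := Nat.exists_eq_add_of_le hvw
    have h' : (2 : ℤ) ^ (j + 3) ∣ 3 ^ v * (3 ^ k - 1) := by
      rw [dvd_sub_comm] at h
      refine dvd_of_dvd_of_eq h ?_
      ring
    have h2 := two_pow_dvd_of_dvd_three_pow_sub_one j
      ((isCoprime_two_pow (Odd.pow (by decide)) _).dvd_of_dvd_mul_left h')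
    have := Nat.eq_zero_of_dvd_of_lt h2 (by omega)
    omega
  have h8 : (8 : ℤ) ∣ 3 ^ v - e * 3 ^ w :=
    (pow_dvd_pow 2 (by omega : 3 ≤ j + 3)).trans h
  rcases he with rfl | rfl
  · rw [one_mul] at h
    rcases le_total v w with hvw | hvw
    · exact key hw hvw h
    · exact (key hv hvw (by rwa [dvd_sub_comm])).symm
  · have h1 := three_pow_emod_eight v
    have h2 := three_pow_emod_eight w
    omega

lemma exists_sq_eq_one_add {a : ℕ} {b q : ℤ} (ha : 2 ≤ a) (hb : Odd b) (hq : q = 2 ^ a * b - 1) :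
    ∃ c : ℤ, Odd c ∧ q ^ 2 = 1 + 2 ^ (a + 1) * c := by
  obtain ⟨k, rfl⟩ := Nat.exists_eq_add_of_le ha
  refine ⟨-b + 2 * (2 ^ k * b ^ 2), hb.neg.add_even (even_two_mul _), ?_⟩
  rw [hq]
  ring

lemma exists_pow_emod_sign {q : ℤ} {i : ℕ} (hq : (2 : ℤ) ^ i ∣ q + 1) (k : ℕ) :
    ∃ e : ℤ, (e = 1 ∨ e = -1) ∧ (2 : ℤ) ^ i ∣ q ^ k - e := by
  refine ⟨(-1) ^ k, neg_one_pow_eq_or ℤ k, ?_⟩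
  have := sub_dvd_pow_sub_pow q (-1) k
  rw [sub_neg_eq_add] at this
  exact hq.trans this

lemma odd_two_pow_mul_sub_one {a : ℕ} {b q : ℤ} (ha : 2 ≤ a) (hq : q = 2 ^ a * b - 1) :
    Odd q := by
  rw [hq]
  exact (((even_two.pow_of_ne_zero (by omega)).mul_right b)).sub_odd odd_one

lemma exists_three_pow_sign_of_two_le {a : ℕ} (ha : 2 ≤ a) {x : ℤ} (hx : Odd x) :
    ∃ v : ℕ, v ≤ 2 ^ (a - 2) - 1 ∧ ∃ e : ℤ, (e = 1 ∨ e = -1) ∧ (2 : ℤ) ^ a ∣ x - e * 3 ^ v := by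
  rcases ha.eq_or_lt with rfl | h3
  · have : x % 4 = 1 ∨ x % 4 = 3 := by
      rcases hx with ⟨k, hk⟩
      omega
    rcases this with h | h
    · exact ⟨0, by norm_num, 1, by norm_num, by norm_num; omega⟩
    · exact ⟨0, by norm_num, -1, by norm_num, by norm_num; omega⟩
  · obtain ⟨j, rfl⟩ := Nat.exists_eq_add_of_le' (show 3 ≤ a from h3)
    obtain ⟨v, hv, h⟩ := exists_three_pow_sign j hx
    exact ⟨v, by simp only [show j + 3 - 2 = j + 1 by omega]; omega, h⟩

lemma three_pow_inj_sign_of_two_le {a : ℕ} (ha : 2 ≤ a) {v w : ℕ} (hv : v ≤ 2 ^ (a - 2) - 1)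
    (hw : w ≤ 2 ^ (a - 2) - 1) {e : ℤ} (he : e = 1 ∨ e = -1)
    (h : (2 : ℤ) ^ a ∣ 3 ^ v - e * 3 ^ w) : v = w := by
  rcases ha.eq_or_lt with rfl | h3
  · norm_num at hv hw
    omega
  · obtain ⟨j, rfl⟩ := Nat.exists_eq_add_of_le' (show 3 ≤ a from h3)
    have h0 : 0 < 2 ^ (j + 1) := by positivity
    rw [show j + 3 - 2 = j + 1 by omega] at hv hw
    exact three_pow_inj_sign j (by omega) (by omega) he h

lemma exists_sign_three_pow_mul_pow {a : ℕ} {b q : ℤ} (ha : 2 ≤ a) (hb : Odd b)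
    (hq : q = 2 ^ a * b - 1) (l : ℕ) {x : ℤ} (hx : Odd x) :
    ∃ v : ℕ, v ≤ 2 ^ (a - 2) - 1 ∧ ∃ e : ℤ, (e = 1 ∨ e = -1) ∧
      ∃ k : ℕ, (2 : ℤ) ^ (a + l) ∣ x - e * 3 ^ v * q ^ k := by
  have hqodd := odd_two_pow_mul_sub_one ha hq
  induction l with
  | zero =>
    obtain ⟨v, hv, e, he, h⟩ := exists_three_pow_sign_of_two_le ha hx
    exact ⟨v, hv, e, he, 0, by simpa using h⟩
  | succ l ih =>
    obtain ⟨v, hv, e, he, k, h⟩ := ih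
    have hodd : Odd (e * 3 ^ v * q ^ k) :=
      ((by rcases he with rfl | rfl <;> decide : Odd e).mul (Odd.pow (by decide))).mul hqodd.pow
    cases l with
    | zero =>
      rcases dvd_sub_or_dvd_sub_mul (u := -q) (c := -b) hodd hb.neg (by rw [hq]; ring) h
        with h' | h'
      · exact ⟨v, hv, e, he, k, h'⟩
      · refine ⟨v, hv, -e, by omega, k + 1, ?_⟩
        refine dvd_of_dvd_of_eq h' ?_
        ring
    | succ l =>
      obtain ⟨c, hc, hu⟩ :=
        exists_odd_pow_two_pow (by omega) (exists_sq_eq_one_add ha hb hq) l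
      rw [show a + 1 + l = a + (l + 1) by ring] at hu
      rcases dvd_sub_or_dvd_sub_mul hodd hc hu h with h' | h'
      · exact ⟨v, hv, e, he, k, h'⟩
      · refine ⟨v, hv, e, he, k + 2 * 2 ^ l, ?_⟩
        rwa [pow_add q, pow_mul, ← mul_assoc]

lemma exists_mem_oddReps {a : ℕ} {b q : ℤ} (ha : 2 ≤ a) (hb : Odd b)
    (hq : q = 2 ^ a * b - 1) (i : ℕ) {x : ℤ} (hx : Odd x) :
    ∃ s ∈ oddReps a i, ∃ k : ℕ, (2 : ℤ) ^ i ∣ x - s * q ^ k := by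
  rcases le_or_gt i a with hia | hia
  · have hq1 : (2 : ℤ) ^ i ∣ q + 1 :=
      (pow_dvd_pow 2 hia).trans ⟨b, by rw [hq]; ring⟩
    have key : ∃ v : ℕ, v ≤ 2 ^ (i - 2) - 1 ∧ ∃ e : ℤ, (e = 1 ∨ e = -1) ∧
        (2 : ℤ) ^ i ∣ x - e * 3 ^ v := by
      rcases le_or_gt 2 i with h2 | h2
      · exact exists_three_pow_sign_of_two_le h2 hx
      · refine ⟨0, by omega, 1, by norm_num, (pow_dvd_pow 2 (show i ≤ 1 by omega)).trans ?_⟩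
        simpa using (hx.sub_odd odd_one).two_dvd
    obtain ⟨v, hv, e, he, h⟩ := key
    refine ⟨3 ^ v, Or.inl ⟨hia, v, hv, rfl⟩, ?_⟩
    rcases he with rfl | rfl
    · exact ⟨0, by simpa using h⟩
    · refine ⟨1, ?_⟩
      have : x - 3 ^ v * q ^ 1 = (x - -1 * 3 ^ v) - 3 ^ v * (q + 1) := by ring
      rw [this]
      exact h.sub (hq1.mul_left _)
  · obtain ⟨l, rfl⟩ := Nat.exists_eq_add_of_le hia.le
    obtain ⟨v, hv, e, he, k, h⟩ := exists_sign_three_pow_mul_pow ha hb hq l hx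
    refine ⟨e * 3 ^ v, Or.inr ⟨hia, v, hv, ?_⟩, k, h⟩
    rcases he with rfl | rfl
    · left; ring
    · right; ring

lemma not_dvd_pow_add_pow {a : ℕ} {b q : ℤ} (ha : 2 ≤ a) (hb : Odd b)
    (hq : q = 2 ^ a * b - 1) (k l : ℕ) : ¬ (2 : ℤ) ^ (a + 1) ∣ q ^ k + q ^ l := by
  obtain ⟨c, -, hc⟩ := exists_sq_eq_one_add ha hb hq
  have hqodd := odd_two_pow_mul_sub_one ha hq
  have h4 : (4 : ℤ) ∣ 2 ^ (a + 1) := pow_dvd_pow 2 (show 2 ≤ a + 1 by omega)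
  have hred : ∀ k : ℕ, (2 : ℤ) ^ (a + 1) ∣ q ^ k - 1 ∨ (2 : ℤ) ^ (a + 1) ∣ q ^ k - q := by
    intro k
    have hs : ∀ t : ℕ, (2 : ℤ) ^ (a + 1) ∣ (q ^ 2) ^ t - 1 := fun t =>
      (Dvd.intro c (by rw [hc]; ring)).trans (sub_one_dvd_pow_sub_one (q ^ 2) t)
    rcases Nat.even_or_odd' k with ⟨t, rfl | rfl⟩
    · left
      rw [pow_mul]
      exact hs t
    · right
      rw [pow_succ q, pow_mul]
      refine dvd_of_dvd_of_eq ((hs t).mul_right q) ?_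
      ring
  have hq1 : ¬ (2 : ℤ) ^ (a + 1) ∣ q + 1 := by
    rw [hq, sub_add_cancel, pow_succ]
    intro h
    have := Int.dvd_of_mul_dvd_mul_left (by positivity) h
    rcases hb with ⟨t, ht⟩
    omega
  intro h
  rcases hred k with hk | hk <;> rcases hred l with hl | hl <;> have h' := (h.sub hk).sub hl
  · have := h4.trans h'
    omega
  · exact hq1 (dvd_of_dvd_of_eq h' (by ring))
  · exact hq1 (dvd_of_dvd_of_eq h' (by ring))
  · have := h4.trans h'
    rcases hqodd with ⟨t, ht⟩
    omega

/-- If `x * q ^ k ≡ y * q ^ l` with `q ≡ -1`, then `x ≡ ± y`. -/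
lemma exists_sign_of_dvd_mul_pow {q x y : ℤ} {i k l : ℕ} (hq : (2 : ℤ) ^ i ∣ q + 1)
    (h : (2 : ℤ) ^ i ∣ x * q ^ k - y * q ^ l) :
    ∃ e : ℤ, (e = 1 ∨ e = -1) ∧ (2 : ℤ) ^ i ∣ x - e * y := by
  obtain ⟨e, he, hk⟩ := exists_pow_emod_sign hq k
  obtain ⟨f, hf, hl⟩ := exists_pow_emod_sign hq l
  have h' : (2 : ℤ) ^ i ∣ x * e - y * f := by
    refine dvd_of_dvd_of_eq ((h.sub (hk.mul_left x)).add (hl.mul_left y)) ?_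
    ring
  refine ⟨e * f, by rcases he with rfl | rfl <;> rcases hf with rfl | rfl <;> norm_num, ?_⟩
  refine dvd_of_dvd_of_eq (h'.mul_left e) ?_
  rcases he with rfl | rfl <;> ring

lemma oddReps_inj {a : ℕ} {b q : ℤ} (ha : 2 ≤ a) (hb : Odd b)
    (hq : q = 2 ^ a * b - 1) {i : ℕ} {s t : ℤ} (hs : s ∈ oddReps a i) (ht : t ∈ oddReps a i)
    {k l : ℕ} (h : (2 : ℤ) ^ i ∣ s * q ^ k - t * q ^ l) : s = t := by
  have hqa : (2 : ℤ) ^ a ∣ q + 1 := ⟨b, by rw [hq]; ring⟩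
  rcases hs with ⟨hia, v, hv, rfl⟩ | ⟨hia, v, hv, hs⟩
  · rcases ht with ⟨-, w, hw, rfl⟩ | ⟨hia', -⟩
    swap
    · omega
    obtain ⟨e, he, h'⟩ := exists_sign_of_dvd_mul_pow ((pow_dvd_pow 2 hia).trans hqa) h
    rcases le_or_gt 2 i with h2 | h2
    · rw [three_pow_inj_sign_of_two_le h2 hv hw he h']
    · rw [show i - 2 = 0 by omega] at hv hw
      rw [show v = w by omega]
  · rcases ht with ⟨hia', -⟩ | ⟨-, w, hw, ht⟩
    · omega
    replace hs : ∃ e : ℤ, (e = 1 ∨ e = -1) ∧ s = e * 3 ^ v := by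
      rcases hs with rfl | rfl
      · exact ⟨1, by norm_num, by ring⟩
      · exact ⟨-1, by norm_num, by ring⟩
    replace ht : ∃ e : ℤ, (e = 1 ∨ e = -1) ∧ t = e * 3 ^ w := by
      rcases ht with rfl | rfl
      · exact ⟨1, by norm_num, by ring⟩
      · exact ⟨-1, by norm_num, by ring⟩
    obtain ⟨e, he, rfl⟩ := hs
    obtain ⟨f, hf, rfl⟩ := ht
    obtain ⟨g, hg, h'⟩ := exists_sign_of_dvd_mul_pow hqa ((pow_dvd_pow 2 hia.le).trans h)
    obtain rfl : v = w := by
      refine three_pow_inj_sign_of_two_le ha hv hw (e := e * g * f) ?_ ?_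
      · rcases he with rfl | rfl <;> rcases hf with rfl | rfl <;>
          rcases hg with rfl | rfl <;> norm_num
      · refine dvd_of_dvd_of_eq (h'.mul_left e) ?_
        rcases he with rfl | rfl <;> ring
    have h1 : (2 : ℤ) ^ (a + 1) ∣ 3 ^ v * (e * q ^ k - f * q ^ l) := by
      refine dvd_of_dvd_of_eq ((pow_dvd_pow 2 (show a + 1 ≤ i from hia)).trans h) ?_
      ring
    have h2 := (isCoprime_two_pow (Odd.pow (by decide)) _).dvd_of_dvd_mul_left h1
    have hn := not_dvd_pow_add_pow ha hb hq k l
    rcases he with rfl | rfl <;> rcases hf with rfl | rfl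
    · rfl
    · exact absurd (dvd_of_dvd_of_eq h2 (by ring)) hn
    · exact absurd (by rw [← dvd_neg]; exact dvd_of_dvd_of_eq h2 (by ring)) hn
    · rfl

lemma not_dvd_two_pow_mul_odd {r i : ℕ} {x : ℤ} (hi : 1 ≤ i) (hir : i ≤ r) (hx : Odd x) :
    ¬ (2 : ℤ) ^ r ∣ 2 ^ (r - i) * x := by
  intro h
  have h' : (2 : ℤ) ^ r ∣ 2 ^ (r - i) := (isCoprime_two_pow hx r).dvd_of_dvd_mul_right h
  have := (pow_dvd_pow_iff (by norm_num) (by decide)).1 h'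
  omega

lemma eq_of_dvd_two_pow_mul_odd_sub {r i j : ℕ} {x y : ℤ} (hi : 1 ≤ i) (hij : i ≤ j) (hj : j ≤ r)
    (hy : Odd y) (h : (2 : ℤ) ^ r ∣ 2 ^ (r - i) * x - 2 ^ (r - j) * y) : i = j := by
  by_contra hne
  have h1 : (2 : ℤ) ^ (r - i) ∣ 2 ^ (r - j) * y := by
    rw [← dvd_sub_right (Dvd.intro x rfl : (2 : ℤ) ^ (r - i) ∣ 2 ^ (r - i) * x)]
    exact (pow_dvd_pow 2 (by omega)).trans h
  have := (pow_dvd_pow_iff (by norm_num) (by decide)).1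
    ((isCoprime_two_pow hy (r - i)).dvd_of_dvd_mul_right h1)
  omega

lemma two_pow_mul_oddReps_inj {a : ℕ} {b q : ℤ} (ha : 2 ≤ a) (hb : Odd b)
    (hq : q = 2 ^ a * b - 1) {r i j : ℕ} {s t : ℤ} (hi : 1 ≤ i) (hir : i ≤ r) (hj : 1 ≤ j)
    (hjr : j ≤ r) (hs : s ∈ oddReps a i) (ht : t ∈ oddReps a j) {k l : ℕ}
    (h : (2 : ℤ) ^ r ∣ 2 ^ (r - i) * (s * q ^ k) - 2 ^ (r - j) * (t * q ^ l)) :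
    i = j ∧ s = t := by
  have hqodd := odd_two_pow_mul_sub_one ha hq
  obtain rfl : i = j := by
    rcases le_total i j with hij | hij
    · exact eq_of_dvd_two_pow_mul_odd_sub hi hij hjr
        ((odd_of_mem_oddReps ht).mul hqodd.pow) h
    · exact (eq_of_dvd_two_pow_mul_odd_sub hj hij hir
        ((odd_of_mem_oddReps hs).mul hqodd.pow) (by rwa [dvd_sub_comm])).symm
  refine ⟨rfl, oddReps_inj ha hb hq hs ht (k := k) (l := l) ?_⟩
  rw [← mul_sub] at h
  refine Int.dvd_of_mul_dvd_mul_left (a := 2 ^ (r - i)) (by positivity) ?_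
  rwa [← pow_add, Nat.sub_add_cancel hir]

/-- Membership in the set of coset representatives, uniformly in the `2`-adic valuation. -/
lemma mem_reps_iff {a r : ℕ} (ha : 2 ≤ a) (hr : 3 ≤ r) (O : ℕ → Set ℤ)
    (hO : ∀ i, 3 ≤ i → i ≤ r →
      O i = if a = 2 then {1, -1}
        else if i ≤ a then {x : ℤ | ∃ v : ℕ, v ≤ 2 ^ (i - 2) - 1 ∧ x = 3 ^ v}
        else {x : ℤ | ∃ v : ℕ, v ≤ 2 ^ (a - 2) - 1 ∧ (x = 3 ^ v ∨ x = -(3 ^ v))}) (t : ℤ) :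
    t ∈ ({0, 2 ^ (r - 1), 2 ^ (r - 2)} ∪
        ⋃ i ∈ Set.Icc 3 r, (fun u : ℤ => 2 ^ (r - i) * u) '' O i : Set ℤ) ↔
      t = 0 ∨ ∃ i, 1 ≤ i ∧ i ≤ r ∧ ∃ s ∈ oddReps a i, t = 2 ^ (r - i) * s := by
  have hOi : ∀ i, 3 ≤ i → i ≤ r → O i = oddReps a i := by
    intro i h3 hi
    rw [hO i h3 hi]
    ext x
    split_ifs with h h'
    · subst h
      simp [oddReps, show ¬ i ≤ 2 by omega, show 2 < i by omega]
    · simp [oddReps, h', show ¬ a < i by omega]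
    · simp [oddReps, h', show a < i by omega]
  have hlow : ∀ i, i ≤ 2 → oddReps a i = {1} := by
    intro i hi
    ext x
    simp [oddReps, show i ≤ a by omega, show ¬ a < i by omega, show i - 2 = 0 by omega]
  simp only [Set.mem_union, Set.mem_insert_iff, Set.mem_singleton_iff, Set.mem_iUnion,
    Set.mem_image, Set.mem_Icc, exists_prop]
  constructor
  · rintro ((h | rfl | rfl) | ⟨i, ⟨h3, hi⟩, s, hs, rfl⟩)
    · exact Or.inl h
    · exact Or.inr ⟨1, le_rfl, by omega, 1, by simp [hlow], by simp⟩
    · exact Or.inr ⟨2, by omega, by omega, 1, by simp [hlow], by simp⟩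
    · exact Or.inr ⟨i, by omega, hi, s, hOi i h3 hi ▸ hs, rfl⟩
  · rintro (h | ⟨i, h1, hi, s, hs, rfl⟩)
    · exact Or.inl (Or.inl h)
    · rcases le_or_gt 3 i with h3 | h3
      · exact Or.inr ⟨i, ⟨h3, hi⟩, s, (hOi i h3 hi).symm ▸ hs, rfl⟩
      · rw [hlow i (by omega)] at hs
        obtain rfl : s = 1 := hs
        left
        rcases (by omega : i = 1 ∨ i = 2) with rfl | rfl <;> simp

lemma intCast_eq_intCast_iff_two_pow_dvd {r : ℕ} {x y : ℤ} :
    (x : ZMod (2 ^ r)) = y ↔ (2 : ℤ) ^ r ∣ x - y := by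
  rw [eq_comm, ZMod.intCast_eq_intCast_iff_dvd_sub]
  push_cast
  rfl

/-- for `q = p^m = 2^a·b − 1` (`p` odd prime, `b` odd, `a ≥ 2`) and `r ≥ 3`,
the set `T_n = {0, 2^{r−1}, 2^{r−2}} ∪ ⋃_{i=3}^r {2^{r−i}·s : s ∈ O_i}` is a complete set of
representatives of the `q`-cyclotomic cosets modulo `2^r`. -/
theorem stmt2 (p m a b r : ℕ) (hp : p.Prime) (hpodd : Odd p) (hm : 0 < m)
    (hb : Odd b) (ha : 2 ≤ a) (hq : (p : ℤ) ^ m = 2 ^ a * b - 1) (hr : 3 ≤ r)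
    (O : ℕ → Set ℤ)
    (hO : ∀ i, 3 ≤ i → i ≤ r →
      O i = if a = 2 then {1, -1}
        else if i ≤ a then {x : ℤ | ∃ v : ℕ, v ≤ 2 ^ (i - 2) - 1 ∧ x = 3 ^ v}
        else {x : ℤ | ∃ v : ℕ, v ≤ 2 ^ (a - 2) - 1 ∧ (x = 3 ^ v ∨ x = -(3 ^ v))})
    (Tn : Set ℤ)
    (hTn : Tn = {0, 2 ^ (r - 1), 2 ^ (r - 2)} ∪
        ⋃ i ∈ Set.Icc 3 r, (fun u : ℤ => 2 ^ (r - i) * u) '' O i) :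
    Tn.Pairwise (fun t₁ t₂ =>
        Disjoint (cycCoset (p ^ m) (2 ^ r) t₁) (cycCoset (p ^ m) (2 ^ r) t₂)) ∧
      ⋃ t ∈ Tn, cycCoset (p ^ m) (2 ^ r) t = Set.univ := by
  have hbz : Odd (b : ℤ) := by exact_mod_cast hb
  have hqodd := odd_two_pow_mul_sub_one ha hq
  have hmem := mem_reps_iff ha hr O hO
  rw [← hTn] at hmem
  constructor
  · intro t₁ ht₁ t₂ ht₂ hne
    rw [Set.disjoint_left]
    rintro z ⟨k, rfl⟩ ⟨l, hl⟩
    apply hne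
    have hd : (2 : ℤ) ^ r ∣ t₁ * ((p : ℤ) ^ m) ^ k - t₂ * ((p : ℤ) ^ m) ^ l := by
      rw [← intCast_eq_intCast_iff_two_pow_dvd]
      push_cast at hl ⊢
      exact hl
    rcases (hmem t₁).1 ht₁ with rfl | ⟨i, hi, hir, s, hs, rfl⟩ <;>
      rcases (hmem t₂).1 ht₂ with rfl | ⟨j, hj, hjr, t, ht, rfl⟩
    · rfl
    · rw [zero_mul, zero_sub, dvd_neg, mul_assoc] at hd
      exact absurd hd (not_dvd_two_pow_mul_odd hj hjr ((odd_of_mem_oddReps ht).mul hqodd.pow))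
    · rw [zero_mul, sub_zero, mul_assoc] at hd
      exact absurd hd (not_dvd_two_pow_mul_odd hi hir ((odd_of_mem_oddReps hs).mul hqodd.pow))
    · rw [mul_assoc, mul_assoc] at hd
      obtain ⟨rfl, rfl⟩ := two_pow_mul_oddReps_inj ha hbz hq hi hir hj hjr hs ht hd
      rfl
  · rw [Set.eq_univ_iff_forall]
    intro z
    simp only [Set.mem_iUnion, exists_prop]
    obtain ⟨x, rfl⟩ := ZMod.intCast_surjective z
    by_cases hx : (2 : ℤ) ^ r ∣ x
    · refine ⟨0, (hmem 0).2 (Or.inl rfl), 0, ?_⟩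
      have : (x : ZMod (2 ^ r)) = ((0 : ℤ) : ZMod (2 ^ r)) := by
        rwa [intCast_eq_intCast_iff_two_pow_dvd, sub_zero]
      rw [this]
      simp
    · have hx0 : x ≠ 0 := by
        rintro rfl
        exact hx (dvd_zero _)
      obtain ⟨e, y, hy, rfl⟩ : ∃ (e : ℕ) (y : ℤ), Odd y ∧ x = 2 ^ e * y := by
        obtain ⟨y, hxy, hy⟩ :=
          (Int.finiteMultiplicity_iff.2 ⟨by decide, hx0⟩ :
            FiniteMultiplicity (2 : ℤ) x).exists_eq_pow_mul_and_not_dvd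
        exact ⟨_, y, by rwa [← Int.not_even_iff_odd, even_iff_two_dvd], hxy⟩
      have her : e < r := by
        by_contra! h
        exact hx ((pow_dvd_pow 2 h).mul_right y)
      obtain ⟨s, hs, k, hk⟩ := exists_mem_oddReps ha hbz hq (r - e) hy
      refine ⟨2 ^ e * s, (hmem _).2 (Or.inr ⟨r - e, by omega, by omega, s, hs, ?_⟩), k, ?_⟩
      · rw [Nat.sub_sub_self her.le]
      · have hd : (2 : ℤ) ^ r ∣ 2 ^ e * y - 2 ^ e * s * ((p : ℤ) ^ m) ^ k := by
          have := mul_dvd_mul_left ((2 : ℤ) ^ e) hk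
          rw [← pow_add, Nat.add_sub_cancel' her.le] at this
          refine dvd_of_dvd_of_eq this ?_
          ring
        rw [← intCast_eq_intCast_iff_two_pow_dvd] at hd
        push_cast at hd ⊢
        exact hd
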